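/- The total weight of the fundamental domain evaluates to $\sum_{\bar{n} \in N_T^d} \frac{1}{|S_{\bar{n}}|} \,=\, \sum_{(d_1,\dots,d_r)} \frac{q^{-\sum_{1 \le i < j \le r} d_i d_j}}{\prod_{i=1}^{r} |GL_{d_i}(\mathbb{F}_q)|} \prod_{l=1}^{r-1} \frac{q^{-e_l}}{1 - q^{-e_l}}$, where the outer sum on the right runs over all compositions $(d_1,\dots,d_r)$ of $d$ (finite sequences of positive integers with $d_1 + \dots + d_r = d$), and $e_l = \sum_{1 \le i \le l < j \le r} d_i d_j$. -/

import Mathlib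

open Matrix Polynomial

noncomputable section

/-- `t = X⁻¹` in the Laurent series field `F = 𝔽_q((X))`. -/
def tF (Fq : Type) [Field Fq] : LaurentSeries Fq := HahnSeries.single (-1 : ℤ) (1 : Fq)

/-- The embedding of the polynomial ring `𝔽_q[t]` into `F = 𝔽_q((X))`, sending the
polynomial variable to `t = X⁻¹`. -/
def polyToF (Fq : Type) [Field Fq] : Polynomial Fq →+* LaurentSeries Fq :=
  Polynomial.eval₂RingHom (HahnSeries.C) (tF Fq)

/-- The lattice `l_n̄ = t^{n₁}𝒪e₁ ⊕ ⋯ ⊕ t^{n_d}𝒪e_d` as an `𝒪`-submodule of `F^d`,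
where `𝒪 = 𝔽_q[[X]]` acts on `F = 𝔽_q((X))` via the inclusion, and
`t^{n} = HahnSeries.single (-n) 1`. -/
def lattM (Fq : Type) [Field Fq] {d : ℕ} (n : Fin d → ℤ) :
    Submodule (PowerSeries Fq) (Fin d → LaurentSeries Fq) :=
  Submodule.span (PowerSeries Fq)
    (Set.range fun i : Fin d =>
      (HahnSeries.single (-(n i)) (1 : Fq) : LaurentSeries Fq) •
        (Pi.single i (1 : LaurentSeries Fq) : Fin d → LaurentSeries Fq))

/-- The image `g L` of an `𝒪`-submodule `L ⊆ F^d` under a matrix `g ∈ M_d(F)`. -/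
def actM (Fq : Type) [Field Fq] {d : ℕ} (g : Matrix (Fin d) (Fin d) (LaurentSeries Fq))
    (L : Submodule (PowerSeries Fq) (Fin d → LaurentSeries Fq)) :
    Submodule (PowerSeries Fq) (Fin d → LaurentSeries Fq) :=
  L.map ((g.mulVecLin).restrictScalars (PowerSeries Fq))

/-- The image `a L` of an `𝒪`-submodule `L ⊆ F^d` under scalar multiplication by `a ∈ F`. -/
def scaleM (Fq : Type) [Field Fq] {d : ℕ} (a : LaurentSeries Fq)
    (L : Submodule (PowerSeries Fq) (Fin d → LaurentSeries Fq)) :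
    Submodule (PowerSeries Fq) (Fin d → LaurentSeries Fq) :=
  L.map ((LinearMap.lsmul (LaurentSeries Fq) (Fin d → LaurentSeries Fq) a).restrictScalars
    (PowerSeries Fq))

/-- The image in `M_d(F)` of a matrix over `𝔽_q[t]`. -/
def glToF (Fq : Type) [Field Fq] {d : ℕ} (γ : GL (Fin d) (Polynomial Fq)) :
    Matrix (Fin d) (Fin d) (LaurentSeries Fq) :=
  (γ : Matrix (Fin d) (Fin d) (Polynomial Fq)).map (polyToF Fq)

/-- The stabilizer `S_n̄ = {γ ∈ GL_d(𝔽_q[t]) : γ l_n̄ = l_n̄}`. -/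
def Stab (Fq : Type) [Field Fq] {d : ℕ} (n : Fin d → ℤ) :
    Set (GL (Fin d) (Polynomial Fq)) :=
  {γ | actM Fq (glToF Fq γ) (lattM Fq n) = lattM Fq n}

/-- `N_T^d`: integer tuples `n₁ ≥ n₂ ≥ ⋯ ≥ n_d = 0`. -/
def NT {d : ℕ} (n : Fin d → ℤ) : Prop :=
  (∀ i j : Fin d, i ≤ j → n j ≤ n i) ∧ ∀ i : Fin d, (i : ℕ) = d - 1 → n i = 0

/-- The difference sequence `m_i = n_i - n_{i+1}`. -/
def mdiff {d : ℕ} (n : Fin d → ℤ) (i : ℕ) (h : i + 1 < d) : ℤ :=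
  n ⟨i, Nat.lt_of_succ_lt h⟩ - n ⟨i + 1, h⟩

end

section Stabilizer

variable {Fq : Type} [Field Fq]

/-- The Laurent series all of whose terms have `t`-degree at most `m`, i.e. `t^m 𝒪`. -/
def tDegreeLE (Fq : Type) [Field Fq] (m : ℤ) : Submodule (PowerSeries Fq) (LaurentSeries Fq) where
  carrier := {f | ∀ k < -m, f.coeff k = 0}
  zero_mem' := by simp
  add_mem' := by
    intro a b ha hb k hk
    simp [ha k hk, hb k hk]
  smul_mem' := by
    intro c f hf k hk
    rw [Algebra.smul_def, LaurentSeries.coe_algebraMap, HahnSeries.coeff_mul]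
    refine Finset.sum_eq_zero fun ij hij => ?_
    rw [Finset.mem_antidiagonal] at hij
    by_cases h : ij.1 < 0
    · rw [PowerSeries.coeff_coe, if_pos h, zero_mul]
    · rw [hf ij.2 (by omega), mul_zero]

lemma mem_tDegreeLE {m : ℤ} {f : LaurentSeries Fq} :
    f ∈ tDegreeLE Fq m ↔ ∀ k < -m, f.coeff k = 0 := Iff.rfl

lemma mem_tDegreeLE_iff_exists {m : ℤ} {f : LaurentSeries Fq} :
    f ∈ tDegreeLE Fq m ↔ ∃ c : PowerSeries Fq, f = c • HahnSeries.single (-m) (1 : Fq) := by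
  constructor
  · intro hf
    refine ⟨PowerSeries.mk fun k => f.coeff (k - m), ?_⟩
    ext k
    rw [Algebra.smul_def, LaurentSeries.coe_algebraMap, HahnSeries.coeff_mul_single,
      PowerSeries.coeff_coe, mul_one]
    split_ifs with h
    · exact hf k (by omega)
    · rw [PowerSeries.coeff_mk]
      congr 1
      omega
  · rintro ⟨c, rfl⟩
    refine Submodule.smul_mem _ _ ?_
    intro k hk
    exact HahnSeries.coeff_single_of_ne hk.ne

lemma mem_lattM {d : ℕ} {n : Fin d → ℤ} {x : Fin d → LaurentSeries Fq} :
    x ∈ lattM Fq n ↔ ∀ i, x i ∈ tDegreeLE Fq (n i) := by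
  constructor
  · intro hx
    have hle : lattM Fq n ≤ Submodule.pi Set.univ fun i => tDegreeLE Fq (n i) := by
      refine Submodule.span_le.2 ?_
      rintro _ ⟨j, rfl⟩ i -
      rcases eq_or_ne i j with rfl | hij
      · simpa using mem_tDegreeLE_iff_exists.2 ⟨1, (one_smul _ _).symm⟩
      · simp [hij]
    exact fun i => hle hx i (Set.mem_univ i)
  · intro hx
    choose c hc using fun i => mem_tDegreeLE_iff_exists.1 (hx i)
    have hsum : x = ∑ i, c i • ((HahnSeries.single (-(n i)) (1 : Fq) : LaurentSeries Fq) •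
        (Pi.single i (1 : LaurentSeries Fq) : Fin d → LaurentSeries Fq)) := by
      ext1 j
      rw [Finset.sum_apply, Finset.sum_eq_single j]
      · simp [hc j]
      · intro i _ hij
        simp [hij.symm]
      · simp
    rw [hsum]
    exact Submodule.sum_mem _ fun i _ =>
      Submodule.smul_mem _ _ (Submodule.subset_span ⟨i, rfl⟩)

lemma actM_lattM_le_iff {d : ℕ} {n : Fin d → ℤ}
    {g : Matrix (Fin d) (Fin d) (LaurentSeries Fq)} :
    actM Fq g (lattM Fq n) ≤ lattM Fq n ↔ ∀ i j, g i j ∈ tDegreeLE Fq (n i - n j) := by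
  have hgen : ∀ j, g *ᵥ ((HahnSeries.single (-(n j)) (1 : Fq) : LaurentSeries Fq) •
      (Pi.single j (1 : LaurentSeries Fq) : Fin d → LaurentSeries Fq)) ∈ lattM Fq n ↔
      ∀ i, g i j ∈ tDegreeLE Fq (n i - n j) := by
    intro j
    rw [mem_lattM]
    refine forall_congr' fun i => ?_
    rw [Matrix.mulVec_smul, Matrix.mulVec_single_one, Pi.smul_apply, smul_eq_mul, mul_comm,
      mem_tDegreeLE, mem_tDegreeLE]
    simp only [HahnSeries.coeff_mul_single, mul_one, Matrix.col_apply]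
    constructor
    · intro h k hk
      simpa using h (k - n j) (by omega)
    · intro h k hk
      exact h _ (by omega)
  rw [actM, lattM, Submodule.map_span_le, forall_comm]
  simp only [Set.forall_mem_range]
  exact forall_congr' hgen

lemma coeff_polyToF (p : Polynomial Fq) (k : ℤ) :
    (polyToF Fq p).coeff k = if k ≤ 0 then p.coeff (-k).toNat else 0 := by
  induction p using Polynomial.induction_on' with
  | add p q hp hq =>
    rw [map_add, HahnSeries.coeff_add, hp, hq]
    split_ifs <;> simp
  | monomial m a =>
    have h : polyToF Fq (Polynomial.monomial m a) = HahnSeries.single (-(m : ℤ)) a := by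
      simp [polyToF, tF, Polynomial.eval₂_monomial, HahnSeries.C_apply]
    rw [h, HahnSeries.coeff_single, Polynomial.coeff_monomial]
    split_ifs <;> first | rfl | omega

lemma polyToF_mem_tDegreeLE {p : Polynomial Fq} {m : ℤ} :
    polyToF Fq p ∈ tDegreeLE Fq m ↔ p ∈ Polynomial.degreeLT Fq (m + 1).toNat := by
  rw [Polynomial.mem_degreeLT, Polynomial.degree_lt_iff_coeff_zero, mem_tDegreeLE]
  simp only [coeff_polyToF]
  constructor
  · intro h k hk
    have := h (-(k : ℤ)) (by omega)
    rwa [if_pos (by omega), neg_neg, Int.toNat_natCast] at this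
  · intro h k hk
    split_ifs with h0
    · exact h _ (by omega)
    · rfl

lemma actM_actM {d : ℕ} (g h : Matrix (Fin d) (Fin d) (LaurentSeries Fq))
    (L : Submodule (PowerSeries Fq) (Fin d → LaurentSeries Fq)) :
    actM Fq (g * h) L = actM Fq g (actM Fq h L) := by
  rw [actM, actM, actM, ← Submodule.map_comp, Matrix.mulVecLin_mul]
  rfl

lemma actM_one {d : ℕ} (L : Submodule (PowerSeries Fq) (Fin d → LaurentSeries Fq)) :
    actM Fq 1 L = L := by
  rw [actM, Matrix.mulVecLin_one]
  exact Submodule.map_id L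

lemma actM_mono {d : ℕ} (g : Matrix (Fin d) (Fin d) (LaurentSeries Fq))
    {L L' : Submodule (PowerSeries Fq) (Fin d → LaurentSeries Fq)} (h : L ≤ L') :
    actM Fq g L ≤ actM Fq g L' :=
  Submodule.map_mono h

lemma glToF_mul {d : ℕ} (γ δ : GL (Fin d) (Polynomial Fq)) :
    glToF Fq (γ * δ) = glToF Fq γ * glToF Fq δ := by
  simp [glToF, Matrix.map_mul]

lemma glToF_one {d : ℕ} : glToF Fq (1 : GL (Fin d) (Polynomial Fq)) = 1 := by
  simp [glToF]

lemma glToF_act_le_iff {d : ℕ} {n : Fin d → ℤ} {γ : GL (Fin d) (Polynomial Fq)} :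
    actM Fq (glToF Fq γ) (lattM Fq n) ≤ lattM Fq n ↔
      ∀ i j, (γ : Matrix (Fin d) (Fin d) (Polynomial Fq)) i j ∈
        Polynomial.degreeLT Fq (n i - n j + 1).toNat := by
  rw [actM_lattM_le_iff]
  simp only [glToF, Matrix.map_apply, polyToF_mem_tDegreeLE]

/-- The submonoid of matrices mapping the lattice into itself. -/
def stabLE (Fq : Type) [Field Fq] {d : ℕ} (n : Fin d → ℤ) :
    Submonoid (GL (Fin d) (Polynomial Fq)) where
  carrier := {γ | actM Fq (glToF Fq γ) (lattM Fq n) ≤ lattM Fq n}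
  one_mem' := by
    rw [Set.mem_ofPred_eq, glToF_one, actM_one]
  mul_mem' := by
    intro a b ha hb
    rw [Set.mem_ofPred_eq, glToF_mul, actM_actM]
    exact (actM_mono _ hb).trans ha

lemma card_degreeLT [Fintype Fq] (m : ℕ) :
    Nat.card (Polynomial.degreeLT Fq m) = Fintype.card Fq ^ m := by
  rw [Nat.card_congr (Polynomial.degreeLTEquiv Fq m).toEquiv]
  simp

instance finite_degreeLT [Finite Fq] (m : ℕ) : Finite (Polynomial.degreeLT Fq m) :=
  .of_equiv _ (Polynomial.degreeLTEquiv Fq m).symm.toEquiv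

lemma finite_stabLE [Finite Fq] {d : ℕ} (n : Fin d → ℤ) : Finite (stabLE Fq n) := by
  refine Finite.of_injective
    (β := ∀ i j, Polynomial.degreeLT Fq (n i - n j + 1).toNat)
    (fun γ i j => ⟨γ.1.1 i j, glToF_act_le_iff.1 γ.2 i j⟩) ?_
  intro γ δ h
  refine Subtype.ext (Units.ext (Matrix.ext fun i j => ?_))
  exact congrArg Subtype.val (congrFun (congrFun h i) j)

lemma mem_Stab_iff [Finite Fq] {d : ℕ} {n : Fin d → ℤ} {γ : GL (Fin d) (Polynomial Fq)} :
    γ ∈ Stab Fq n ↔ ∀ i j, (γ : Matrix (Fin d) (Fin d) (Polynomial Fq)) i j ∈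
        Polynomial.degreeLT Fq (n i - n j + 1).toNat := by
  rw [← glToF_act_le_iff]
  refine ⟨fun h => le_of_eq h, fun h => le_antisymm h ?_⟩
  have := finite_stabLE (Fq := Fq) n
  have hfin : IsOfFinOrder γ := by
    rw [← finite_powers]
    exact (Set.toFinite (stabLE Fq n : Set _)).subset ((Submonoid.powers_le (P := stabLE Fq n)).2 h)
  have hinv : γ⁻¹ ∈ stabLE Fq n := by
    have h1 : γ⁻¹ ∈ Submonoid.powers γ :=
      hfin.mem_powers_iff_mem_zpowers.2 (inv_mem (Subgroup.mem_zpowers γ))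
    exact (Submonoid.powers_le (P := stabLE Fq n)).2 h h1
  have := actM_mono (glToF Fq γ) (show actM Fq (glToF Fq γ⁻¹) (lattM Fq n) ≤ lattM Fq n from hinv)
  rwa [← actM_actM, ← glToF_mul, mul_inv_cancel, glToF_one, actM_one] at this

end Stabilizer

section Count

variable {Fq : Type} [Field Fq]

/-- Invertible matrices, described by their determinants. -/
noncomputable def glEquivDet (m R : Type*) [Fintype m] [DecidableEq m] [CommRing R] :
    GL m R ≃ {A : Matrix m m R // IsUnit A.det} :=
  Equiv.ofBijective (fun g => ⟨g.1, (Matrix.isUnit_iff_isUnit_det _).1 g.isUnit⟩)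
    ⟨fun _ _ h => Units.ext (congrArg Subtype.val h), fun A =>
      ⟨((Matrix.isUnit_iff_isUnit_det _).2 A.2).unit, rfl⟩⟩

lemma coe_glEquivDet_symm {m R : Type*} [Fintype m] [DecidableEq m] [CommRing R]
    (A : {A : Matrix m m R // IsUnit A.det}) :
    (((glEquivDet m R).symm A : GL m R) : Matrix m m R) = A.1 :=
  congrArg Subtype.val ((glEquivDet m R).apply_symm_apply A)

variable {d r : ℕ} {n : Fin d → ℤ} {b : Fin d → Fin r}

/-- Polynomial matrices whose `(i, j)` entry has degree at most `n i - n j`. -/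
def BoundedDegree (n : Fin d → ℤ) (M : Matrix (Fin d) (Fin d) (Polynomial Fq)) : Prop :=
  ∀ i j, M i j ∈ Polynomial.degreeLT Fq (n i - n j + 1).toNat

/-- The matrix of constant coefficients of the `k`-th diagonal block. -/
def constBlock (b : Fin d → Fin r) (M : Matrix (Fin d) (Fin d) (Polynomial Fq)) (k : Fin r) :
    Matrix {i // b i = k} {i // b i = k} Fq :=
  Matrix.of fun i j => (M i j).coeff 0

/-- The matrix with constant diagonal blocks `A` and upper triangular entries `P`. -/
noncomputable def ofBlocks (b : Fin d → Fin r)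
    (A : ∀ k, Matrix {i // b i = k} {i // b i = k} Fq)
    (P : {p : Fin d × Fin d // b p.1 < b p.2} → Polynomial Fq) :
    Matrix (Fin d) (Fin d) (Polynomial Fq) :=
  Matrix.of fun i j =>
    if h : b i = b j then Polynomial.C (A (b j) ⟨i, h⟩ ⟨j, rfl⟩)
    else if h : b i < b j then P ⟨(i, j), h⟩ else 0

lemma BoundedDegree.apply_eq_zero {M : Matrix (Fin d) (Fin d) (Polynomial Fq)}
    (hM : BoundedDegree n M) {i j : Fin d} (h : n i < n j) : M i j = 0 := by
  have h1 := hM i j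
  rw [show (n i - n j + 1).toNat = 0 by omega, Polynomial.mem_degreeLT] at h1
  exact Polynomial.degree_eq_bot.1 (Nat.WithBot.lt_zero_iff.1 h1)

lemma BoundedDegree.apply_eq_C {M : Matrix (Fin d) (Fin d) (Polynomial Fq)}
    (hM : BoundedDegree n M) {i j : Fin d} (h : n i = n j) :
    M i j = Polynomial.C ((M i j).coeff 0) := by
  have h1 := hM i j
  rw [h, sub_self, Polynomial.mem_degreeLT] at h1
  exact Polynomial.eq_C_of_degree_le_zero (Nat.WithBot.lt_one_iff_le_zero.1 h1)

lemma BoundedDegree.isUnit_det_iff {v : Fin r → ℤ} (hv : StrictAnti v)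
    {M : Matrix (Fin d) (Fin d) (Polynomial Fq)} (hM : BoundedDegree (v ∘ b) M) :
    IsUnit M.det ↔ ∀ k, IsUnit (constBlock b M k).det := by
  have hT : Matrix.BlockTriangular M b := fun i j hij => hM.apply_eq_zero (hv hij)
  rw [hT.det_fintype, IsUnit.prod_univ_iff]
  refine forall_congr' fun k => ?_
  have hk : M.toSquareBlock b k = (constBlock b M k).map Polynomial.C := by
    ext1 i j
    exact hM.apply_eq_C (congrArg v (i.2.trans j.2.symm))
  rw [hk, ← RingHom.mapMatrix_apply, ← RingHom.map_det, Polynomial.isUnit_C]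

lemma boundedDegree_ofBlocks {v : Fin r → ℤ}
    (A : ∀ k, Matrix {i // b i = k} {i // b i = k} Fq)
    (P : ∀ p : {p : Fin d × Fin d // b p.1 < b p.2},
      Polynomial.degreeLT Fq (v (b p.1.1) - v (b p.1.2) + 1).toNat) :
    BoundedDegree (v ∘ b) (ofBlocks b A fun p => (P p).1) := by
  intro i j
  simp only [ofBlocks, Matrix.of_apply, Function.comp_apply]
  split_ifs with h h'
  · rw [show (v (b i) - v (b j) + 1).toNat = 1 by simp [h], Polynomial.mem_degreeLT]
    exact Nat.WithBot.lt_one_iff_le_zero.2 Polynomial.degree_C_le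
  · exact (P ⟨(i, j), h'⟩).2
  · exact Submodule.zero_mem _

lemma constBlock_ofBlocks (A : ∀ k, Matrix {i // b i = k} {i // b i = k} Fq)
    (P : {p : Fin d × Fin d // b p.1 < b p.2} → Polynomial Fq) (k : Fin r) :
    constBlock b (ofBlocks b A P) k = A k := by
  ext ⟨i, hi⟩ ⟨j, rfl⟩
  simp [constBlock, ofBlocks, hi]

lemma BoundedDegree.ofBlocks_constBlock {v : Fin r → ℤ} (hv : StrictAnti v)
    {M : Matrix (Fin d) (Fin d) (Polynomial Fq)} (hM : BoundedDegree (v ∘ b) M) :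
    ofBlocks b (constBlock b M) (fun p => M p.1.1 p.1.2) = M := by
  ext1 i j
  simp only [ofBlocks, Matrix.of_apply, constBlock]
  split_ifs with h h'
  · exact (hM.apply_eq_C (congrArg v h)).symm
  · rfl
  · exact (hM.apply_eq_zero (hv (lt_of_le_of_ne (not_lt.1 h') (Ne.symm h)))).symm

/-- A stabilizer is a product of general linear groups and spaces of polynomials. -/
noncomputable def stabEquiv [Finite Fq] (b : Fin d → Fin r) {v : Fin r → ℤ} (hv : StrictAnti v) :
    Stab Fq (v ∘ b) ≃ (∀ k, GL {i // b i = k} Fq) ×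
      ∀ p : {p : Fin d × Fin d // b p.1 < b p.2},
        Polynomial.degreeLT Fq (v (b p.1.1) - v (b p.1.2) + 1).toNat where
  toFun γ := ⟨fun k => (glEquivDet _ _).symm ⟨constBlock b γ.1.1 k,
      ((BoundedDegree.isUnit_det_iff hv (mem_Stab_iff.1 γ.2)).1 (glEquivDet _ _ γ.1).2) k⟩,
    fun p => ⟨γ.1.1 p.1.1 p.1.2, mem_Stab_iff.1 γ.2 _ _⟩⟩
  invFun x := ⟨(glEquivDet _ _).symm ⟨ofBlocks b (fun k => (x.1 k).1) fun p => (x.2 p).1, by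
      rw [BoundedDegree.isUnit_det_iff hv (boundedDegree_ofBlocks _ _)]
      intro k
      rw [constBlock_ofBlocks]
      exact (glEquivDet _ _ (x.1 k)).2⟩, by
    rw [mem_Stab_iff, coe_glEquivDet_symm]
    exact boundedDegree_ofBlocks (fun k => (x.1 k).1) x.2⟩
  left_inv γ := by
    refine Subtype.ext (Units.ext ?_)
    simp only [coe_glEquivDet_symm]
    exact BoundedDegree.ofBlocks_constBlock hv (mem_Stab_iff.1 γ.2)
  right_inv x := by
    refine Prod.ext (funext fun k => Units.ext ?_) (funext fun p => Subtype.ext ?_)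
    · simp only [coe_glEquivDet_symm, constBlock_ofBlocks]
    · simp only [coe_glEquivDet_symm]
      simp [ofBlocks, p.2, p.2.ne]

lemma card_Stab_comp [Fintype Fq] (b : Fin d → Fin r) {v : Fin r → ℤ} (hv : StrictAnti v) :
    Nat.card (Stab Fq (v ∘ b)) = (∏ k, Nat.card (GL {i // b i = k} Fq)) *
      Fintype.card Fq ^ ∑ i, ∑ j, if b i < b j then (v (b i) - v (b j) + 1).toNat else 0 := by
  rw [Nat.card_congr (stabEquiv b hv), Nat.card_prod, Nat.card_pi, Nat.card_pi]
  simp only [card_degreeLT]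
  rw [Finset.prod_pow_eq_pow_sum, ← Fintype.sum_prod_type', ← Finset.sum_filter]
  congr 2
  symm
  exact Finset.sum_subtype (p := fun p : Fin d × Fin d => b p.1 < b p.2) _ (by simp) _

end Count

section Sequences

variable {r : ℕ}

/-- The strictly decreasing sequence ending in `0` whose successive differences are `m l + 1`. -/
def gapSeq (m : Fin (r - 1) → ℕ) (k : Fin r) : ℤ :=
  ∑ l : Fin (r - 1), if (k : ℕ) ≤ l then (m l : ℤ) + 1 else 0

lemma gapSeq_sub (m : Fin (r - 1) → ℕ) {k k' : Fin r} (h : k ≤ k') :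
    gapSeq m k - gapSeq m k' =
      ((∑ l : Fin (r - 1), if (k : ℕ) ≤ l ∧ (l : ℕ) < k' then m l + 1 else 0 : ℕ) : ℤ) := by
  rw [gapSeq, gapSeq, ← Finset.sum_sub_distrib, Nat.cast_sum]
  refine Finset.sum_congr rfl fun l _ => ?_
  have : (k : ℕ) ≤ k' := h
  split_ifs <;> omega

lemma gapSeq_succ (m : Fin (r - 1) → ℕ) (l : Fin (r - 1)) :
    gapSeq m ⟨l, by omega⟩ - gapSeq m ⟨l + 1, by omega⟩ = m l + 1 := by
  rw [gapSeq_sub m (Fin.mk_le_mk.2 (Nat.le_succ _)), Finset.sum_eq_single l]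
  · simp
  · intro l' _ hl'
    rw [if_neg]
    intro h
    exact hl' (Fin.ext (by simp only at h; omega))
  · simp

lemma gapSeq_strictAnti (m : Fin (r - 1) → ℕ) : StrictAnti (gapSeq m) := by
  intro k k' h
  have hk : (k : ℕ) < k' := h
  rw [← sub_pos, gapSeq_sub m h.le, Nat.cast_pos]
  refine Finset.sum_pos' (fun _ _ => Nat.zero_le _) ⟨⟨k, by omega⟩, Finset.mem_univ _, ?_⟩
  simp [hk]

lemma gapSeq_last (m : Fin (r - 1) → ℕ) {k : Fin r} (hk : (k : ℕ) = r - 1) : gapSeq m k = 0 :=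
  Finset.sum_eq_zero fun l _ => if_neg (by omega)

lemma gapSeq_injective : Function.Injective (gapSeq (r := r)) := by
  intro m m' h
  ext l
  have h1 := gapSeq_succ m l
  rw [h, gapSeq_succ m' l] at h1
  omega

lemma exists_gapSeq_eq {v : Fin r → ℤ} (hv : StrictAnti v)
    (h0 : ∀ k : Fin r, (k : ℕ) = r - 1 → v k = 0) : ∃ m, gapSeq m = v := by
  refine ⟨fun l => (v ⟨l, by omega⟩ - v ⟨l + 1, by omega⟩ - 1).toNat, funext fun k => ?_⟩
  obtain ⟨t, ht⟩ : ∃ t, (k : ℕ) + t = r - 1 := ⟨r - 1 - k, by omega⟩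
  induction t generalizing k with
  | zero => rw [gapSeq_last _ ht, h0 k ht]
  | succ t ih =>
    have h1 := gapSeq_succ (fun l : Fin (r - 1) =>
      (v ⟨l, by omega⟩ - v ⟨l + 1, by omega⟩ - 1).toNat) ⟨k, by omega⟩
    have h2 := ih ⟨k + 1, by omega⟩ (by simp only; omega)
    have h3 : v ⟨k + 1, by omega⟩ < v k := hv (Fin.lt_def.2 (Nat.lt_succ_self _))
    simp only [Fin.eta] at h1
    rw [h2] at h1
    omega

end Sequences

section Compositions

variable {d : ℕ}

lemma Composition.index_mono (c : Composition d) : Monotone c.index := by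
  intro i j hij
  by_contra! h
  have h1 := c.sizeUpTo_index_le i
  have h2 := c.lt_sizeUpTo_index_succ j
  have h3 : c.sizeUpTo (c.index j).succ ≤ c.sizeUpTo (c.index i) := c.monotone_sizeUpTo h
  have : (i : ℕ) ≤ j := hij
  omega

lemma Composition.index_surjective (c : Composition d) : Function.Surjective c.index :=
  fun k => ⟨c.embedding k ⟨0, c.one_le_blocksFun k⟩, c.index_embedding _ _⟩

lemma Composition.index_last (c : Composition d) {i : Fin d} (hi : (i : ℕ) = d - 1) :
    (c.index i : ℕ) = c.length - 1 := by
  obtain ⟨j, hj⟩ := c.index_surjective ⟨c.length - 1, by have := (c.index i).2; omega⟩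
  have h1 : c.index j ≤ c.index i := c.index_mono (Fin.le_def.2 (by omega))
  rw [hj, Fin.le_def] at h1
  have := (c.index i).2
  simp only at h1
  omega

lemma Composition.card_index_eq (c : Composition d) (k : Fin c.length) :
    Fintype.card {i // c.index i = k} = c.blocksFun k := by
  have e : {i // c.index i = k} ≃ Fin (c.blocksFun k) :=
    (c.blocksFinEquiv.symm.subtypeEquiv
      (q := fun x : Σ k, Fin (c.blocksFun k) => x.1 = k) fun _ => Iff.rfl).trans
      (Equiv.sigmaSubtype k)
  rw [Fintype.card_congr e, Fintype.card_fin]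

lemma Composition.sum_index {M : Type*} [AddCommMonoid M] (c : Composition d)
    (f : Fin c.length → M) : ∑ i, f (c.index i) = ∑ k, c.blocksFun k • f k := by
  rw [← c.blocksFinEquiv.sum_comp, Fintype.sum_sigma]
  refine Finset.sum_congr rfl fun k _ => ?_
  simp [Composition.blocksFinEquiv]

/-- The values of a tuple, in decreasing order. -/
def sortedValues (n : Fin d → ℤ) : List ℤ :=
  (Finset.univ.image n).sort (· ≥ ·)

lemma sortedValues_comp_index (c : Composition d) {v : Fin c.length → ℤ} (hv : StrictAnti v) :
    sortedValues (v ∘ c.index) = List.ofFn v := by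
  have h1 : Finset.univ.image (v ∘ c.index) = (List.ofFn v).toFinset := by
    ext a
    simp [c.index_surjective.exists]
  rw [sortedValues, h1, List.toFinset_sort _ (List.nodup_ofFn.2 hv.injective)]
  rw [List.pairwise_ofFn]
  exact fun i j hij => (hv hij).le

lemma blocks_eq_map_sortedValues (c : Composition d) {v : Fin c.length → ℤ} (hv : StrictAnti v) :
    c.blocks = (sortedValues (v ∘ c.index)).map
      fun a => Fintype.card {i // (v ∘ c.index) i = a} := by
  rw [sortedValues_comp_index c hv, List.map_ofFn, ← c.ofFn_blocksFun]
  congr 1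
  funext k
  rw [← c.card_index_eq k]
  exact Fintype.card_congr (Equiv.subtypeEquivRight fun i => hv.injective.eq_iff.symm)

lemma eq_of_antitone_of_card_eq {f g : Fin d → ℤ} (hf : Antitone f) (hg : Antitone g)
    (h : ∀ a, Fintype.card {i // f i = a} = Fintype.card {i // g i = a}) : f = g := by
  have hcount : ∀ (f : Fin d → ℤ) (a : ℤ),
      (List.ofFn f).count a = Fintype.card {i // f i = a} := by
    intro f a
    rw [← Multiset.coe_count, ← Fin.univ_val_map, Multiset.count_map, Fintype.card_subtype,
      Finset.card_def, Finset.filter_val]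
    simp only [eq_comm]
  have hperm : (List.ofFn f).Perm (List.ofFn g) :=
    List.perm_iff_count.2 fun a => by rw [hcount, hcount, h]
  refine List.ofFn_injective (hperm.eq_of_pairwise' (r := (· ≥ ·)) ?_ ?_)
  · exact List.pairwise_ofFn.2 fun i j hij => hf hij.le
  · exact List.pairwise_ofFn.2 fun i j hij => hg hij.le

lemma exists_comp_index_eq {n : Fin d → ℤ} (hn : Antitone n) :
    ∃ (c : Composition d) (v : Fin c.length → ℤ), StrictAnti v ∧ v ∘ c.index = n := by
  set N : ℤ → ℕ := fun a => Fintype.card {i // n i = a} with hN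
  have hnodup : (sortedValues n).Nodup := Finset.sort_nodup _ _
  have hmem : ∀ a, a ∈ sortedValues n ↔ ∃ i, n i = a := by simp [sortedValues]
  let c : Composition d :=
    { blocks := (sortedValues n).map N
      blocks_pos := by
        intro k hk
        obtain ⟨a, ha, rfl⟩ := List.mem_map.1 hk
        obtain ⟨i, hi⟩ := (hmem a).1 ha
        exact Fintype.card_pos_iff.2 ⟨⟨i, hi⟩⟩
      blocks_sum := by
        rw [← List.sum_toFinset _ hnodup, sortedValues, Finset.sort_toFinset]
        simp only [hN, Fintype.card_subtype]
        rw [← Finset.card_eq_sum_card_image, Finset.card_univ, Fintype.card_fin] }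
  have hlen : c.length = (sortedValues n).length := List.length_map _
  let v : Fin c.length → ℤ := fun k => (sortedValues n)[k]
  have hblock : ∀ k, c.blocksFun k = N (v k) := by
    intro k
    simp [Composition.blocksFun, c, v]
  have hv : StrictAnti v := by
    intro k k' hk
    refine lt_of_le_of_ne ?_ ?_
    · exact List.pairwise_iff_getElem.1 (Finset.pairwise_sort (Finset.univ.image n) (· ≥ ·))
        k k' _ _ hk
    · intro h
      exact hk.ne' (Fin.ext (hnodup.getElem_inj_iff.1 h))
  refine ⟨c, v, hv, eq_of_antitone_of_card_eq (hv.antitone.comp_monotone c.index_mono) hn ?_⟩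
  intro a
  by_cases ha : a ∈ sortedValues n
  · obtain ⟨k, hk, rfl⟩ := List.getElem_of_mem ha
    have h1 := hblock ⟨k, hlen ▸ hk⟩
    rw [← c.card_index_eq] at h1
    refine Eq.trans (Fintype.card_congr (Equiv.subtypeEquivRight fun i => ?_)) h1
    exact hv.injective.eq_iff (b := ⟨k, _⟩)
  · have h1 : IsEmpty {i // n i = a} := ⟨fun i => ha ((hmem a).2 ⟨i.1, i.2⟩)⟩
    have h2 : IsEmpty {i // (v ∘ c.index) i = a} :=
      ⟨fun i => ha (i.2 ▸ List.getElem_mem _)⟩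
    rw [Fintype.card_eq_zero, Fintype.card_eq_zero]

/-- The tuple in `N_T^d` attached to a composition and a sequence of gaps. -/
def toNT (x : Σ c : Composition d, Fin (c.length - 1) → ℕ) : {n : Fin d → ℤ // NT n} :=
  ⟨gapSeq x.2 ∘ x.1.index,
    fun _ _ hij => (gapSeq_strictAnti x.2).antitone (x.1.index_mono hij),
    fun _ hi => gapSeq_last x.2 (x.1.index_last hi)⟩

lemma toNT_bijective : Function.Bijective (toNT (d := d)) := by
  constructor
  · rintro ⟨c, m⟩ ⟨c', m'⟩ h
    replace h : gapSeq m ∘ c.index = gapSeq m' ∘ c'.index := congrArg Subtype.val h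
    obtain rfl : c = c' := by
      refine Composition.ext ?_
      rw [blocks_eq_map_sortedValues c (gapSeq_strictAnti m),
        blocks_eq_map_sortedValues c' (gapSeq_strictAnti m'), h]
    rw [gapSeq_injective (c.index_surjective.injective_comp_right h)]
  · rintro ⟨n, hn, hn0⟩
    obtain ⟨c, v, hv, rfl⟩ := exists_comp_index_eq fun i j hij => hn i j hij
    obtain ⟨m, rfl⟩ := exists_gapSeq_eq hv fun k hk => by
      obtain ⟨i, rfl⟩ := c.index_surjective k
      have hd : d - 1 < d := by have := i.2; omega
      have h1 : c.index ⟨d - 1, hd⟩ = c.index i :=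
        Fin.ext ((c.index_last rfl).trans hk.symm)
      rw [← h1]
      exact hn0 _ rfl
    exact ⟨⟨c, m⟩, rfl⟩

end Compositions

section Covolume

lemma hasSum_pi_geometric {s : ℕ} (x : Fin s → ℝ) (h0 : ∀ l, 0 ≤ x l) (h1 : ∀ l, x l < 1) :
    HasSum (fun m : Fin s → ℕ => ∏ l, x l ^ (m l + 1)) (∏ l, x l / (1 - x l)) := by
  induction s with
  | zero =>
    convert! hasSum_unique fun m : Fin 0 → ℕ => ∏ l, x l ^ (m l + 1) using 1
  | succ s ih =>
    have hhead : HasSum (fun k : ℕ => x 0 ^ (k + 1)) (x 0 / (1 - x 0)) := by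
      simpa only [pow_succ', div_eq_mul_inv] using
        (hasSum_geometric_of_lt_one (h0 0) (h1 0)).mul_left (x 0)
    have htail := ih (fun l => x l.succ) (fun l => h0 _) fun l => h1 _
    have hsummable := hhead.summable.mul_of_nonneg htail.summable
      (fun k => pow_nonneg (h0 0) (k + 1))
      (fun m => Finset.prod_nonneg fun l _ => pow_nonneg (h0 l.succ) (m l + 1))
    rw [Fin.prod_univ_succ, ← (Fin.consEquiv fun _ => ℕ).hasSum_iff]
    convert! hhead.mul htail hsummable using 1
    funext p
    simp [Fin.prod_univ_succ, Fin.consEquiv]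

variable {d : ℕ}

lemma Composition.sum_sum_index (c : Composition d) (F : Fin c.length → Fin c.length → ℕ) :
    ∑ i, ∑ j, F (c.index i) (c.index j) =
      ∑ k, ∑ k', c.blocksFun k * c.blocksFun k' * F k k' := by
  rw [c.sum_index fun k => ∑ j, F k (c.index j)]
  refine Finset.sum_congr rfl fun k _ => ?_
  rw [c.sum_index (F k), smul_eq_mul, Finset.mul_sum]
  simp only [smul_eq_mul, mul_assoc]

/-- The exponent `∑_{i < j} dᵢ dⱼ` of a composition. -/
def pairSum (c : Composition d) : ℕ :=
  ∑ i : Fin c.length, ∑ j : Fin c.length, if i < j then c.blocksFun i * c.blocksFun j else 0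

/-- The exponent `e_l = ∑_{i ≤ l < j} dᵢ dⱼ` of a composition. -/
def cutSum (c : Composition d) (l : Fin (c.length - 1)) : ℕ :=
  ∑ i : Fin c.length, ∑ j : Fin c.length,
    if (i : ℕ) ≤ (l : ℕ) ∧ (l : ℕ) < (j : ℕ) then c.blocksFun i * c.blocksFun j else 0

lemma cutSum_pos (c : Composition d) (l : Fin (c.length - 1)) : 0 < cutSum c l := by
  refine Finset.sum_pos' (fun _ _ => Nat.zero_le _) ⟨⟨l, by omega⟩, Finset.mem_univ _, ?_⟩
  refine Finset.sum_pos' (fun _ _ => Nat.zero_le _) ⟨⟨l + 1, by omega⟩, Finset.mem_univ _, ?_⟩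
  rw [if_pos ⟨le_rfl, Nat.lt_succ_self _⟩]
  exact Nat.mul_pos (c.one_le_blocksFun _) (c.one_le_blocksFun _)

lemma pairSum_add_sum_cutSum (c : Composition d) (w : Fin (c.length - 1) → ℕ) :
    pairSum c + ∑ l, cutSum c l * w l =
      ∑ k : Fin c.length, ∑ k' : Fin c.length, c.blocksFun k * c.blocksFun k' *
        ((if k < k' then 1 else 0) +
          ∑ l : Fin (c.length - 1), if (k : ℕ) ≤ l ∧ (l : ℕ) < k' then w l else 0) := by
  simp only [mul_add, Finset.sum_add_distrib, pairSum, cutSum]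
  congr 1
  · simp only [mul_ite, mul_one, mul_zero]
  · simp only [Finset.mul_sum, Finset.sum_mul]
    conv_rhs => rw [Finset.sum_comm_cycle]
    simp only [mul_ite, mul_zero, ite_mul, zero_mul]

lemma sum_gapSeq_index (c : Composition d) (m : Fin (c.length - 1) → ℕ) :
    (∑ i, ∑ j, if c.index i < c.index j then
      (gapSeq m (c.index i) - gapSeq m (c.index j) + 1).toNat else 0) =
      pairSum c + ∑ l, cutSum c l * (m l + 1) := by
  rw [c.sum_sum_index fun k k' => if k < k' then (gapSeq m k - gapSeq m k' + 1).toNat else 0,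
    pairSum_add_sum_cutSum c fun l => m l + 1]
  refine Finset.sum_congr rfl fun k _ => Finset.sum_congr rfl fun k' _ => congrArg _ ?_
  by_cases h : k < k'
  · rw [if_pos h, if_pos h, gapSeq_sub m h.le]
    omega
  · rw [if_neg h, if_neg h, zero_add]
    refine (Finset.sum_eq_zero fun l _ => if_neg ?_).symm
    rw [Fin.lt_def] at h
    omega

lemma card_GL_index (Fq : Type) [Field Fq] (c : Composition d) (k : Fin c.length) :
    Nat.card (GL {i // c.index i = k} Fq) = Nat.card (GL (Fin (c.blocksFun k)) Fq) :=
  Nat.card_congr (Units.mapEquiv (Matrix.reindexAlgEquiv Fq Fq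
    (Fintype.equivFinOfCardEq (c.card_index_eq k))).toMulEquiv).toEquiv

lemma inv_card_Stab_gapSeq (Fq : Type) [Field Fq] [Fintype Fq] (c : Composition d)
    (m : Fin (c.length - 1) → ℕ) :
    ((Nat.card (Stab Fq (gapSeq m ∘ c.index)) : ℝ))⁻¹ =
      (((Fintype.card Fq : ℝ) ^ pairSum c)⁻¹ /
        ∏ i, (Nat.card (GL (Fin (c.blocksFun i)) Fq) : ℝ)) *
      ∏ l, (((Fintype.card Fq : ℝ) ^ cutSum c l)⁻¹) ^ (m l + 1) := by
  rw [card_Stab_comp c.index (gapSeq_strictAnti m), sum_gapSeq_index,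
    Finset.prod_congr rfl fun k _ => card_GL_index Fq c k, pow_add, ← Finset.prod_pow_eq_pow_sum]
  simp only [Nat.cast_mul, Nat.cast_prod, Nat.cast_pow, pow_mul, inv_pow, Finset.prod_inv_distrib,
    div_eq_mul_inv, mul_inv]
  rw [← mul_assoc, mul_comm (∏ k, _)⁻¹]

lemma hasSum_inv_card_Stab_gapSeq (Fq : Type) [Field Fq] [Fintype Fq] (c : Composition d) :
    HasSum (fun m => ((Nat.card (Stab Fq (gapSeq m ∘ c.index)) : ℝ))⁻¹)
      ((((Fintype.card Fq : ℝ) ^ pairSum c)⁻¹ /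
          ∏ i, (Nat.card (GL (Fin (c.blocksFun i)) Fq) : ℝ)) *
        ∏ l, (((Fintype.card Fq : ℝ) ^ cutSum c l)⁻¹ /
          (1 - ((Fintype.card Fq : ℝ) ^ cutSum c l)⁻¹))) := by
  have hq1 : (1 : ℝ) < Fintype.card Fq := by exact_mod_cast Fintype.one_lt_card
  simp only [inv_card_Stab_gapSeq]
  exact (hasSum_pi_geometric (fun l => ((Fintype.card Fq : ℝ) ^ cutSum c l)⁻¹)
    (fun l => by positivity)
    (fun l => inv_lt_one_of_one_lt₀ (one_lt_pow₀ hq1 (cutSum_pos c l).ne'))).mul_left _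

lemma summable_inv_card_Stab_gapSeq (Fq : Type) [Field Fq] [Fintype Fq] (d : ℕ) :
    Summable fun x : Σ c : Composition d, Fin (c.length - 1) → ℕ =>
      ((Nat.card (Stab Fq (gapSeq x.2 ∘ x.1.index)) : ℝ))⁻¹ :=
  (summable_sigma_of_nonneg fun _ => inv_nonneg.2 (Nat.cast_nonneg _)).2
    ⟨fun c => (hasSum_inv_card_Stab_gapSeq Fq c).summable, Summable.of_finite⟩

lemma tsum_inv_card_Stab (Fq : Type) [Field Fq] [Fintype Fq] (d : ℕ) :
    ∑' n : {n : Fin d → ℤ // NT n}, ((Nat.card (Stab Fq n.1) : ℝ))⁻¹ =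
      ∑ c : Composition d, (((Fintype.card Fq : ℝ) ^ pairSum c)⁻¹ /
          ∏ i, (Nat.card (GL (Fin (c.blocksFun i)) Fq) : ℝ)) *
        ∏ l, (((Fintype.card Fq : ℝ) ^ cutSum c l)⁻¹ /
          (1 - ((Fintype.card Fq : ℝ) ^ cutSum c l)⁻¹)) := by
  have hreindex : ∑' n : {n : Fin d → ℤ // NT n}, ((Nat.card (Stab Fq n.1) : ℝ))⁻¹ =
      ∑' x : Σ c : Composition d, Fin (c.length - 1) → ℕ,
        ((Nat.card (Stab Fq (gapSeq x.2 ∘ x.1.index)) : ℝ))⁻¹ :=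
    ((Equiv.ofBijective toNT toNT_bijective).tsum_eq
      fun n : {n : Fin d → ℤ // NT n} => ((Nat.card (Stab Fq n.1) : ℝ))⁻¹).symm
  rw [hreindex, (summable_inv_card_Stab_gapSeq Fq d).tsum_sigma, tsum_fintype]
  exact Finset.sum_congr rfl fun c _ => (hasSum_inv_card_Stab_gapSeq Fq c).tsum_eq

end Covolume

open Matrix Polynomial in
/-- the total weight of the fundamental domain evaluates to a finite sum over
compositions `(d₁,…,d_r)` of `d`:
`∑_{n̄ ∈ N_T^d} 1/|S_n̄| = ∑_{(d₁,…,d_r)} q^{-∑_{i<j} dᵢdⱼ} / ∏ᵢ |GL_{dᵢ}(𝔽_q)| ⬝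
  ∏_{l=1}^{r-1} q^{-e_l}/(1 - q^{-e_l})` with `e_l = ∑_{i ≤ l < j} dᵢdⱼ`. -/
theorem covolume_formula (Fq : Type) [Field Fq] [Fintype Fq] (d : ℕ) (hd : 2 ≤ d)
    (q : ℕ) (hq : q = Fintype.card Fq) :
    ∑' n : {n : Fin d → ℤ // NT n}, ((Nat.card (Stab Fq n.1) : ℝ))⁻¹ =
      ∑ c : Composition d,
        (((q : ℝ) ^ (∑ i : Fin c.length, ∑ j : Fin c.length,
              if i < j then c.blocksFun i * c.blocksFun j else 0))⁻¹ /
            ∏ i : Fin c.length, (Nat.card (GL (Fin (c.blocksFun i)) Fq) : ℝ)) *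
          ∏ l : Fin (c.length - 1),
            (((q : ℝ) ^ (∑ i : Fin c.length, ∑ j : Fin c.length,
                if (i : ℕ) ≤ (l : ℕ) ∧ (l : ℕ) < (j : ℕ) then
                  c.blocksFun i * c.blocksFun j else 0))⁻¹ /
              (1 - ((q : ℝ) ^ (∑ i : Fin c.length, ∑ j : Fin c.length,
                if (i : ℕ) ≤ (l : ℕ) ∧ (l : ℕ) < (j : ℕ) then
                  c.blocksFun i * c.blocksFun j else 0))⁻¹)) := by
  rw [hq, tsum_inv_card_Stab]
  rfl
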